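/- arXiv:1606.07916 — 4 statements merged into one kernel-verified Lean document; each statement's English description precedes it below -/
import Mathlib

section
/- The expected cascade function f is submodular on the solution space H = V × D: for all configurations A ⊆ B ⊆ H and every seed–discount pair h ∈ H ∖ B, f(A ∪ {h}) − f(A) ≥ f(B ∪ {h}) − f(B). -/
open Finset

/-- The set of nodes that are in `U` or reachable from some node of `U`
along a directed path of edges in `A`. -/
def reach {V : Type*} (A : Finset (V × V)) (U : Finset V) : Set V :=
  {v | ∃ u ∈ U, Relation.ReflTransGen (fun a b => (a, b) ∈ A) u v}

/-- Expected cascade `I(U)` of a seed set `U` under the independent cascade model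
with edge set `E` and propagation probabilities `pe`. -/
noncomputable def expCascade {V : Type*} [DecidableEq V]
    (E : Finset (V × V)) (pe : V × V → ℝ) (U : Finset V) : ℝ :=
  ∑ A ∈ E.powerset, (∏ e ∈ A, pe e) * (∏ e ∈ E \ A, (1 - pe e)) * (reach A U).ncard

/-- `d_S[v]`: the highest discount assigned to `v` under configuration `S`
(`0` if `v` is assigned no discount). -/
noncomputable def dS {V : Type*} [DecidableEq V] (S : Finset (V × ℝ)) (v : V) : ℝ :=
  (insert (0 : ℝ) ((S.filter (fun h => h.1 = v)).image Prod.snd)).max' (insert_nonempty _ _)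

/-- `Pr(U; S)`: the probability that `U` is the seed set under configuration `S`. -/
noncomputable def seedProb {V : Type*} [Fintype V] [DecidableEq V]
    (p : V → ℝ → ℝ) (S : Finset (V × ℝ)) (U : Finset V) : ℝ :=
  (∏ u ∈ U, p u (dS S u)) * ∏ v ∈ Uᶜ, (1 - p v (dS S v))

/-- `f(S)`: the expected cascade of a configuration `S`. -/
noncomputable def expCascadeConfig {V : Type*} [Fintype V] [DecidableEq V]
    (E : Finset (V × V)) (pe : V × V → ℝ) (p : V → ℝ → ℝ) (S : Finset (V × ℝ)) : ℝ :=
  ∑ U ∈ (Finset.univ : Finset V).powerset, seedProb p S U * expCascade E pe U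

theorem sum_disjoint_aux {V : Type*} [Fintype V] [DecidableEq V] (q : V → ℝ) (R : Finset V) :
    ∑ U ∈ (Finset.univ : Finset V).powerset,
      ((∏ u ∈ U, q u) * ∏ v ∈ Uᶜ, (1 - q v)) * (if Disjoint U R then 1 else 0)
      = ∏ u ∈ R, (1 - q u) := by
  have key := Finset.prod_add (fun i => if i ∈ R then 0 else q i) (fun i => 1 - q i)
    (Finset.univ : Finset V)
  have h1 : ∏ i : V, ((if i ∈ R then 0 else q i) + (1 - q i)) = ∏ u ∈ R, (1 - q u) := by
    rw [← Finset.prod_subset (Finset.subset_univ R)]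
    · exact Finset.prod_congr rfl fun i hi => by simp [hi]
    · intro i _ hi
      simp [hi]
  rw [← h1, key]
  refine Finset.sum_congr rfl fun U _ => ?_
  rw [← Finset.compl_eq_univ_sdiff]
  split_ifs with hd
  · rw [mul_one]
    congr 1
    refine Finset.prod_congr rfl fun i hi => ?_
    rw [if_neg (Finset.disjoint_left.mp hd hi)]
  · rw [Finset.not_disjoint_iff] at hd
    obtain ⟨i, hi, hR⟩ := hd
    have hz : (∏ i ∈ U, if i ∈ R then 0 else q i) = 0 :=
      Finset.prod_eq_zero hi (if_pos hR)
    rw [hz]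
    simp

/-- nodes that reach `w` along live edges. -/
noncomputable def revReach {V : Type*} [Fintype V] (A : Finset (V × V)) (w : V) : Finset V :=
  by
    classical
    exact Finset.univ.filter (fun u => Relation.ReflTransGen (fun a b => (a, b) ∈ A) u w)

theorem ncard_reach_aux {V : Type*} [Fintype V] [DecidableEq V] (A : Finset (V × V))
    (U : Finset V) :
    ((reach A U).ncard : ℝ) = ∑ w : V, (1 - if Disjoint U (revReach A w) then 1 else 0) := by
  classical
  rw [Set.ncard_eq_toFinset_card', Finset.card_eq_sum_ones, Nat.cast_sum,
    ← Finset.sum_filter_add_sum_filter_not Finset.univ (fun w => w ∈ reach A U)]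
  have h : ∀ w, Disjoint U (revReach A w) ↔ w ∉ reach A U := by
    intro w
    rw [Finset.disjoint_left]
    simp [revReach, reach]
  have e : (reach A U).toFinset = Finset.univ.filter (fun w => w ∈ reach A U) := by
    ext; simp
  simp only [h, e]
  rw [Finset.sum_congr (s₁ := Finset.univ.filter (fun w => ¬ w ∈ reach A U)) rfl
    (g := fun _ => (0 : ℝ)) (by intro w hw; simp at hw; simp [hw])]
  rw [Finset.sum_const_zero, add_zero]
  refine Finset.sum_congr rfl fun w hw => ?_
  simp at hw
  simp [hw]

theorem seedProb_sum {V : Type*} [Fintype V] [DecidableEq V]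
    (p : V → ℝ → ℝ) (S : Finset (V × ℝ)) :
    ∑ U ∈ (Finset.univ : Finset V).powerset, seedProb p S U = 1 := by
  have := sum_disjoint_aux (fun v => p v (dS S v)) ∅
  simpa [seedProb] using this

theorem config_closed {V : Type*} [Fintype V] [DecidableEq V]
    (E : Finset (V × V)) (pe : V × V → ℝ) (p : V → ℝ → ℝ) (S : Finset (V × ℝ)) :
    expCascadeConfig E pe p S = ∑ A ∈ E.powerset,
      (∏ e ∈ A, pe e) * (∏ e ∈ E \ A, (1 - pe e)) *
        ∑ w : V, (1 - ∏ u ∈ revReach A w, (1 - p u (dS S u))) := by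
  unfold expCascadeConfig expCascade
  simp only [Finset.mul_sum (s := E.powerset)]
  rw [Finset.sum_comm]
  refine Finset.sum_congr rfl fun A _ => ?_
  have : ∀ U, seedProb p S U * ((∏ e ∈ A, pe e) * (∏ e ∈ E \ A, (1 - pe e)) *
      ((reach A U).ncard : ℝ)) = ((∏ e ∈ A, pe e) * (∏ e ∈ E \ A, (1 - pe e))) *
      (∑ w : V, (seedProb p S U - seedProb p S U *
        if Disjoint U (revReach A w) then 1 else 0)) := by
    intro U
    rw [ncard_reach_aux, mul_left_comm, Finset.mul_sum]
    congr 1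
    refine Finset.sum_congr rfl fun w _ => by ring
  simp only [this]
  rw [← Finset.mul_sum, Finset.sum_comm]
  congr 1
  refine Finset.sum_congr rfl fun w _ => ?_
  rw [Finset.sum_sub_distrib, seedProb_sum]
  congr 1
  exact sum_disjoint_aux (fun v => p v (dS S v)) _

theorem dS_mono {V : Type*} [DecidableEq V] {S T : Finset (V × ℝ)} (h : S ⊆ T) (v : V) :
    dS S v ≤ dS T v := by
  unfold dS
  apply Finset.max'_subset
  gcongr

theorem dS_mem {V : Type*} [Fintype V] [DecidableEq V] {S : Finset (V × ℝ)} {D : Finset ℝ}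
    (h : S ⊆ Finset.univ ×ˢ D) (v : V) : dS S v ∈ insert (0 : ℝ) D := by
  have := Finset.max'_mem (insert (0 : ℝ) ((S.filter (fun h => h.1 = v)).image Prod.snd))
    (insert_nonempty _ _)
  change dS S v ∈ _ at this
  rw [Finset.mem_insert] at this ⊢
  refine this.imp id fun h2 => ?_
  obtain ⟨x, hx, hx2⟩ := Finset.mem_image.mp h2
  have := h (Finset.mem_filter.mp hx).1
  rw [← hx2]
  exact (Finset.mem_product.mp this).2

theorem dS_insert_ne {V : Type*} [DecidableEq V] (S : Finset (V × ℝ)) (h : V × ℝ) (v : V)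
    (hv : v ≠ h.1) : dS (insert h S) v = dS S v := by
  unfold dS
  simp only [Finset.filter_insert, if_neg (Ne.symm hv)]

theorem dS_insert_self {V : Type*} [DecidableEq V] (S : Finset (V × ℝ)) (h : V × ℝ) :
    dS (insert h S) h.1 = max (dS S h.1) h.2 := by
  unfold dS
  simp only [Finset.filter_insert, if_true, Finset.image_insert]
  simp only [Finset.insert_comm (0 : ℝ) h.2]
  rw [Finset.max'_insert _ _ (insert_nonempty _ _), max_comm]

/-- The expected cascade function `f` is submodular on the solution space `H = V × D`. -/
theorem expCascadeConfig_submodular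
    {V : Type*} [Fintype V] [DecidableEq V]
    (E : Finset (V × V)) (pe : V × V → ℝ)
    (hpe : ∀ e ∈ E, 0 ≤ pe e ∧ pe e ≤ 1)
    (D : Finset ℝ) (hD : ∀ d ∈ D, 0 < d)
    (p : V → ℝ → ℝ)
    (hp0 : ∀ v, p v 0 = 0)
    (hp01 : ∀ v, ∀ d ∈ insert (0 : ℝ) D, 0 ≤ p v d ∧ p v d ≤ 1)
    (hpmono : ∀ v, ∀ d₁ ∈ insert (0 : ℝ) D, ∀ d₂ ∈ insert (0 : ℝ) D,
      d₁ ≤ d₂ → p v d₁ ≤ p v d₂)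
    (A B : Finset (V × ℝ)) (hAB : A ⊆ B) (hBH : B ⊆ Finset.univ ×ˢ D)
    (h : V × ℝ) (hh : h ∈ (Finset.univ ×ˢ D) \ B) :
    expCascadeConfig E pe p (insert h A) - expCascadeConfig E pe p A ≥
      expCascadeConfig E pe p (insert h B) - expCascadeConfig E pe p B := by
  have hhD : h.2 ∈ D := (Finset.mem_product.mp (Finset.mem_sdiff.mp hh).1).2
  have hAH := hAB.trans hBH
  have hself : ∀ S : Finset (V × ℝ), S ⊆ Finset.univ ×ˢ D →
      p h.1 (dS (insert h S) h.1) = max (p h.1 (dS S h.1)) (p h.1 h.2) := by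
    intro S hS
    rw [dS_insert_self]
    have m1 := dS_mem hS h.1
    have m2 : h.2 ∈ insert (0 : ℝ) D := Finset.mem_insert_of_mem hhD
    rcases le_total (dS S h.1) h.2 with hle | hle
    · rw [max_eq_right hle, max_eq_right (hpmono _ _ m1 _ m2 hle)]
    · rw [max_eq_left hle, max_eq_left (hpmono _ _ m2 _ m1 hle)]
  have hdiff : ∀ S : Finset (V × ℝ), S ⊆ Finset.univ ×ˢ D → ∀ R : Finset V, h.1 ∈ R →
      (1 - ∏ u ∈ R, (1 - p u (dS (insert h S) u))) - (1 - ∏ u ∈ R, (1 - p u (dS S u)))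
      = (∏ u ∈ R.erase h.1, (1 - p u (dS S u))) *
        (max (p h.1 (dS S h.1)) (p h.1 h.2) - p h.1 (dS S h.1)) := by
    intro S hS R hR
    rw [← Finset.mul_prod_erase R _ hR, ← Finset.mul_prod_erase R _ hR, hself S hS]
    rw [Finset.prod_congr (s₁ := R.erase h.1) rfl (fun u hu => by
      rw [dS_insert_ne S h u (Finset.ne_of_mem_erase hu)])]
    ring
  have hpAB : ∀ v, p v (dS A v) ≤ p v (dS B v) := fun v =>
    hpmono v _ (dS_mem hAH v) _ (dS_mem hBH v) (dS_mono hAB v)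
  rw [config_closed, config_closed, config_closed, config_closed, ge_iff_le,
    ← Finset.sum_sub_distrib, ← Finset.sum_sub_distrib]
  refine Finset.sum_le_sum fun L hL => ?_
  rw [Finset.mem_powerset] at hL
  rw [← mul_sub, ← mul_sub, ← Finset.sum_sub_distrib, ← Finset.sum_sub_distrib]
  refine mul_le_mul_of_nonneg_left (Finset.sum_le_sum fun w _ => ?_) ?_
  · by_cases hR : h.1 ∈ revReach L w
    · rw [hdiff A hAH _ hR, hdiff B hBH _ hR]
      refine mul_le_mul ?_ ?_ ?_ ?_
      · refine Finset.prod_le_prod (fun u _ => ?_) (fun u _ => ?_)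
        · linarith [(hp01 u _ (dS_mem hBH u)).2]
        · linarith [hpAB u]
      · have := hpAB h.1
        rcases max_cases (p h.1 (dS B h.1)) (p h.1 h.2) with hc | hc <;>
        linarith [le_max_left (p h.1 (dS A h.1)) (p h.1 h.2),
          le_max_right (p h.1 (dS A h.1)) (p h.1 h.2)]
      · exact sub_nonneg.mpr (le_max_left _ _)
      · exact Finset.prod_nonneg fun u _ => by linarith [(hp01 u _ (dS_mem hAH u)).2]
    · have hz : ∀ S : Finset (V × ℝ), ∏ u ∈ revReach L w, (1 - p u (dS (insert h S) u))
          = ∏ u ∈ revReach L w, (1 - p u (dS S u)) := fun S =>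
        Finset.prod_congr rfl fun u hu => by
          rw [dS_insert_ne S h u (fun e => hR (e ▸ hu))]
      rw [hz, hz, sub_self, sub_self]
  · refine mul_nonneg (Finset.prod_nonneg fun e he => (hpe e (hL he)).1)
      (Finset.prod_nonneg fun e he => ?_)
    linarith [(hpe e (Finset.mem_sdiff.mp he).1).2]
end

section
/- The expected cascade I of the independent cascade model is submodular as a function of the seed set: for all U ⊆ W ⊆ V and every v ∈ V ∖ W, I(U ∪ {v}) − I(U) ≥ I(W ∪ {v}) − I(W). -/
open Finset

lemma reach_insert_ncard {V : Type*} [Fintype V] [DecidableEq V]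
    (A : Finset (V × V)) (S : Finset V) (v : V) :
    ((reach A (insert v S)).ncard : ℝ) =
      (reach A S).ncard + (reach A {v} \ reach A S).ncard := by
  have h : reach A (insert v S) = reach A S ∪ (reach A {v} \ reach A S) := by
    rw [Set.union_sdiff_self]
    ext x
    simp [reach, or_comm]
  rw [h, Set.ncard_union_eq Set.disjoint_sdiff_right (Set.toFinite _) (Set.toFinite _)]
  push_cast
  rfl

/-- The expected cascade `I` of the independent cascade model is submodular as a
function of the seed set. -/
theorem expCascade_submodular
    {V : Type*} [Fintype V] [DecidableEq V]
    (E : Finset (V × V)) (pe : V × V → ℝ)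
    (hpe : ∀ e ∈ E, 0 ≤ pe e ∧ pe e ≤ 1)
    (U W : Finset V) (hUW : U ⊆ W) (v : V) (hv : v ∉ W) :
    expCascade E pe (insert v U) - expCascade E pe U ≥
      expCascade E pe (insert v W) - expCascade E pe W := by
  unfold expCascade
  rw [ge_iff_le, ← Finset.sum_sub_distrib, ← Finset.sum_sub_distrib]
  apply Finset.sum_le_sum
  intro A hA
  rw [Finset.mem_powerset] at hA
  rw [← mul_sub, ← mul_sub]
  apply mul_le_mul_of_nonneg_left
  · rw [reach_insert_ncard, reach_insert_ncard, add_sub_cancel_left, add_sub_cancel_left]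
    have : (reach A {v} \ reach A W).ncard ≤ (reach A {v} \ reach A U).ncard := by
      apply Set.ncard_le_ncard _ (Set.toFinite _)
      rintro x ⟨hx, hx'⟩
      exact ⟨hx, fun ⟨u, hu, h⟩ => hx' ⟨u, hUW hu, h⟩⟩
    exact_mod_cast this
  · apply mul_nonneg
    · exact Finset.prod_nonneg fun e he => (hpe e (hA he)).1
    · exact Finset.prod_nonneg fun e he =>
        sub_nonneg.2 (hpe e (Finset.mem_sdiff.1 he).1).2
end

section
/- For a monotone submodular function f on a finite ground set H with cost function c : H → ℝ_{>0}, any current set S ⊆ H, and any set O ⊆ H with c(O) ≤ B and f(O) > f(S), there exists an element h ∈ O ∖ S whose marginal benefit-to-cost ratio satisfies (f(S ∪ {h}) − f(S))/c(h) ≥ (f(O) − f(S))/B. -/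
open Finset

/-- For a monotone submodular function `f` on a finite ground set with positive costs
`c`, any current set `S`, and any set `O` with `c(O) ≤ B` and `f(O) > f(S)`, there is
an element `h ∈ O \ S` whose marginal benefit-to-cost ratio is at least
`(f(O) − f(S)) / B`. -/
theorem exists_good_ratio_element
    {ι : Type*} [Fintype ι] [DecidableEq ι]
    (c : ι → ℝ) (hc : ∀ h : ι, 0 < c h) (B : ℝ)
    (f : Finset ι → ℝ)
    (hmono : ∀ X Y : Finset ι, X ⊆ Y → f X ≤ f Y)
    (hsub : ∀ X Y : Finset ι, X ⊆ Y → ∀ x ∉ Y,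
      f (insert x X) - f X ≥ f (insert x Y) - f Y)
    (S O : Finset ι) (hO : ∑ h ∈ O, c h ≤ B) (hfO : f S < f O) :
    ∃ h ∈ O \ S, (f (insert h S) - f S) / c h ≥ (f O - f S) / B := by
  have key : ∀ T : Finset ι, Disjoint T S →
      f (T ∪ S) - f S ≤ ∑ h ∈ T, (f (insert h S) - f S) := by
    intro T
    induction T using Finset.induction_on with
    | empty => intro _; simp
    | insert a T ha ih =>
      intro hd
      rw [Finset.disjoint_insert_left] at hd
      have h1 := ih hd.2
      have h2 := hsub S (T ∪ S) Finset.subset_union_right a (by simp [ha, hd.1])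
      rw [Finset.sum_insert ha, Finset.insert_union]
      linarith
  have hk := key (O \ S) Finset.sdiff_disjoint
  rw [Finset.sdiff_union_self_eq_union] at hk
  have hm := hmono O (O ∪ S) Finset.subset_union_left
  have hne : (O \ S).Nonempty := by
    rw [Finset.nonempty_iff_ne_empty]
    intro h
    rw [Finset.sdiff_eq_empty_iff_subset] at h
    have := hmono O S h
    linarith
  have hcT : ∑ h ∈ O \ S, c h ≤ ∑ h ∈ O, c h :=
    Finset.sum_le_sum_of_subset_of_nonneg Finset.sdiff_subset
      (fun i _ _ => (hc i).le)
  have hpos : 0 < ∑ h ∈ O \ S, c h := Finset.sum_pos (fun i _ => hc i) hne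
  have hB : 0 < B := by linarith
  by_contra! hcon
  have hlt : ∑ h ∈ O \ S, (f (insert h S) - f S)
      < ∑ h ∈ O \ S, (f O - f S) / B * c h :=
    Finset.sum_lt_sum_of_nonempty hne
      (fun i hi => (div_lt_iff₀ (hc i)).mp (hcon i hi))
  rw [← Finset.mul_sum] at hlt
  have hr : 0 ≤ (f O - f S) / B := div_nonneg (by linarith) hB.le
  have h3 := mul_le_mul_of_nonneg_left (hcT.trans hO) hr
  rw [div_mul_cancel₀ _ hB.ne'] at h3
  linarith
end

section
/- The cost-sensitive greedy sequence satisfies an exponential guarantee: let H be a finite ground set, c : H → ℝ_{>0} a cost function, B > 0 a budget, and f : 2^H → ℝ a monotone submodular function with f(∅) = 0. Let h_1, …, h_k be a sequence in which, writing S^i = {h_1, …, h_i}, each h_{i+1} maximizes the marginal gain per unit cost (f(S^i ∪ {h}) − f(S^i))/c(h) over h ∈ H ∖ S^i. Then f(S^k) ≥ (1 − e^{−c(S^k)/B}) · max{f(O) : O ⊆ H, c(O) ≤ B}. In particular, if c(S^k) ≥ B − d_max, where d_max is the maximum cost of any single element, then f(S^k) ≥ (1 − e^{−(B − d_max)/B})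 · max{f(O) : O ⊆ H, c(O) ≤ B}. -/
open Finset

/-- The cost-sensitive greedy sequence satisfies an exponential guarantee:
`f(S^k) ≥ (1 − e^{−c(S^k)/B}) · max{f(O) : c(O) ≤ B}`, and in particular, if
`c(S^k) ≥ B − d_max` (where `d_max` is the maximum cost of any single element), then
`f(S^k) ≥ (1 − e^{−(B − d_max)/B}) · max{f(O) : c(O) ≤ B}`. Here `e i` is the
`(i+1)`-st greedy pick `h_{i+1}` and `S^i = (range i).image e = {h_1, …, h_i}`. -/
theorem greedy_exponential_guarantee
    {ι : Type*} [Fintype ι] [DecidableEq ι] [Nonempty ι]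
    (c : ι → ℝ) (hc : ∀ h : ι, 0 < c h) (B : ℝ) (hB : 0 < B)
    (f : Finset ι → ℝ)
    (hmono : ∀ X Y : Finset ι, X ⊆ Y → f X ≤ f Y)
    (hsub : ∀ X Y : Finset ι, X ⊆ Y → ∀ x ∉ Y,
      f (insert x X) - f X ≥ f (insert x Y) - f Y)
    (hf0 : f ∅ = 0)
    (k : ℕ) (e : ℕ → ι)
    (hgreedy : ∀ i < k,
      e i ∉ (Finset.range i).image e ∧
      ∀ h ∉ (Finset.range i).image e,
        (f (insert h ((Finset.range i).image e)) - f ((Finset.range i).image e)) / c h ≤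
        (f (insert (e i) ((Finset.range i).image e)) - f ((Finset.range i).image e)) /
          c (e i)) :
    (∀ O : Finset ι, ∑ h ∈ O, c h ≤ B →
      f ((Finset.range k).image e) ≥
        (1 - Real.exp (-(∑ x ∈ (Finset.range k).image e, c x) / B)) * f O) ∧
    ((∑ x ∈ (Finset.range k).image e, c x ≥ B - Finset.univ.sup' univ_nonempty c) →
      ∀ O : Finset ι, ∑ h ∈ O, c h ≤ B →
        f ((Finset.range k).image e) ≥
          (1 - Real.exp (-(B - Finset.univ.sup' univ_nonempty c) / B)) * f O) := by
  have hfnn : ∀ O : Finset ι, 0 ≤ f O := fun O => hf0 ▸ hmono ∅ O (Finset.empty_subset O)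
  have main : ∀ O : Finset ι, ∑ h ∈ O, c h ≤ B →
      f ((Finset.range k).image e) ≥
        (1 - Real.exp (-(∑ x ∈ (Finset.range k).image e, c x) / B)) * f O := by
    intro O hO
    have key : ∀ i ≤ k, f O - f ((Finset.range i).image e) ≤
        Real.exp (-(∑ x ∈ (Finset.range i).image e, c x) / B) * f O := by
      intro i
      induction i with
      | zero => intro _; simp [hf0]
      | succ i ih =>
        intro hi
        have ih := ih (by omega)
        obtain ⟨hn, hg⟩ := hgreedy i (by omega)
        rw [Finset.range_add_one, Finset.image_insert, Finset.sum_insert hn]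
        generalize (Finset.range i).image e = S at *
        have hci := hc (e i)
        obtain ⟨r, hr⟩ : ∃ r, r = (f (insert (e i) S) - f S) / c (e i) := ⟨_, rfl⟩
        rw [← hr] at hg
        have hr0 : 0 ≤ r := by
          rw [hr]
          exact div_nonneg (sub_nonneg.2 (hmono _ _ (Finset.subset_insert _ _))) hci.le
        have hrc : f (insert (e i) S) - f S = r * c (e i) := by
          rw [hr]; field_simp
        have hT : ∀ T : Finset ι, f (S ∪ T) - f S ≤ r * ∑ x ∈ T, c x := by
          intro T
          induction T using Finset.induction_on with
          | empty => simp
          | insert a T ha ihT =>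
            rw [Finset.sum_insert ha, Finset.union_insert, mul_add]
            by_cases h : a ∈ S ∪ T
            · rw [Finset.insert_eq_self.2 h]
              have := mul_nonneg hr0 (hc a).le
              linarith
            · have h1 := hsub S (S ∪ T) Finset.subset_union_left a h
              have h2 := hg a (fun h' => h (Finset.mem_union_left _ h'))
              rw [div_le_iff₀ (hc a)] at h2
              linarith
        have hD : f O - f S ≤ r * B := by
          have h1 := hT O
          have h2 := hmono O (S ∪ O) Finset.subset_union_right
          have h3 := mul_le_mul_of_nonneg_left hO hr0
          linarith
        have hexp : Real.exp (-(c (e i) + ∑ x ∈ S, c x) / B) =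
            Real.exp (-(c (e i) / B)) * Real.exp (-(∑ x ∈ S, c x) / B) := by
          rw [← Real.exp_add]; congr 1; ring
        have hstep : f O - f (insert (e i) S) ≤ (f O - f S) * (1 - c (e i) / B) := by
          have h1 : (f O - f S) * (c (e i) / B) ≤ r * B * (c (e i) / B) :=
            mul_le_mul_of_nonneg_right hD (by positivity)
          have h2 : r * B * (c (e i) / B) = r * c (e i) := by field_simp
          linarith
        rw [hexp]
        rcases le_total 0 (f O - f S) with h | h
        · have h1 : 1 - c (e i) / B ≤ Real.exp (-(c (e i) / B)) :=
            Real.one_sub_le_exp_neg _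
          have h2 := mul_le_mul_of_nonneg_left h1 h
          have h3 := mul_le_mul_of_nonneg_left ih (Real.exp_pos (-(c (e i) / B))).le
          linarith
        · have h1 : 0 ≤ Real.exp (-(c (e i) / B)) * Real.exp (-(∑ x ∈ S, c x) / B) * f O :=
            mul_nonneg (by positivity) (hfnn O)
          have h2 := hmono S (insert (e i) S) (Finset.subset_insert _ _)
          linarith
    have := key k le_rfl
    linarith
  refine ⟨main, fun hcost O hO => ?_⟩
  have h1 := main O hO
  refine ge_trans h1 (mul_le_mul_of_nonneg_right ?_ (hfnn O))
  apply sub_le_sub_left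
  apply Real.exp_le_exp.2
  apply div_le_div_of_nonneg_right _ hB.le
  linarith
end
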